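/- arXiv:2307.10910 — 3 statements merged into one kernel-verified Lean document; each statement's English description precedes it below -/
import Mathlib

section
/- Let k ≥ 1 and let G be a connected simple graph which is neither a path graph nor an extended star graph. Then G is circularly k-partite if and only if (1) the length of every cycle in G is a multiple of k, and (2) for every path of length ℓ connecting two distinct vertices of degree ≥ 3, the number 2ℓ is a multiple of k. -/
open SimpleGraph Function

/-- A circular `k`-colouring of the oriented edges of `G`: every colour class is nonempty
(on adjacent pairs), and the colour increases by one along every non-backtracking step. -/
def IsCircularColoring {V : Type*} (G : SimpleGraph V) (k : ℕ) (c : V → V → ZMod k) : Prop :=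
  (∀ j : ZMod k, ∃ v w, G.Adj v w ∧ c v w = j) ∧
  ∀ v w z, G.Adj v w → G.Adj w z → z ≠ v → c w z = c v w + 1

/-- `G` is circularly `k`-partite. -/
def CircularlyPartite {V : Type*} (G : SimpleGraph V) (k : ℕ) : Prop :=
  0 < k ∧ ∃ c : V → V → ZMod k, IsCircularColoring G k c

/-- The oriented edge periodic colouring number: the largest `k` such that `G` is
circularly `k`-partite. -/
noncomputable def chiO {V : Type*} (G : SimpleGraph V) : ℕ :=
  sSup {k | CircularlyPartite G k}

/-- `G` is a path graph. -/
def IsPathGraph {V : Type*} (G : SimpleGraph V) : Prop :=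
  ∃ n, Nonempty (G ≃g pathGraph n)

/-- `G` is an extended star graph: a tree with exactly one vertex of degree at least 3. -/
def IsExtendedStar {V : Type*} [Fintype V] (G : SimpleGraph V) [DecidableRel G.Adj] : Prop :=
  G.IsTree ∧ ∃! v : V, 3 ≤ G.degree v

/-- A (not necessarily proper) vertex colouring is `t`-periodic if every path of length `t`
has endpoints of the same colour. -/
def IsPeriodicColoring {V : Type*} (G : SimpleGraph V) (t : ℕ) {α : Type*} (c : V → α) : Prop :=
  ∀ (u v : V) (p : G.Walk u v), p.IsPath → p.length = t → c u = c v

/-- The vertex `t`-periodic colouring number: the largest `k` such that `G` admits a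
`t`-periodic colouring using exactly `k` colours. -/
noncomputable def chiT {V : Type*} (G : SimpleGraph V) (t : ℕ) : ℕ :=
  sSup {k | ∃ c : V → Fin k, Surjective c ∧ IsPeriodicColoring G t c}

/-- A proper edge colouring: distinct edges sharing an endpoint get distinct colours. -/
def IsProperEdgeColoring {V : Type*} (G : SimpleGraph V) {α : Type*} (c : G.edgeSet → α) : Prop :=
  ∀ e f : G.edgeSet, e ≠ f → (∃ v, v ∈ (e : Sym2 V) ∧ v ∈ (f : Sym2 V)) → c e ≠ c f

/-- The edge chromatic number of `G`. -/
noncomputable def chiStar {V : Type*} (G : SimpleGraph V) : ℕ :=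
  sInf {k | ∃ c : G.edgeSet → Fin k, IsProperEdgeColoring G c}

section Forward

variable {V : Type*} {G : SimpleGraph V} {k : ℕ} {c : V → V → ZMod k}

/-- Along a non-backtracking walk the colour of the `i`-th step is that of the first, plus `i`. -/
lemma IsCircularColoring.color_getVert (hc : IsCircularColoring G k c) {u v : V} (p : G.Walk u v)
    (hp : ∀ i, i + 2 ≤ p.length → p.getVert i ≠ p.getVert (i + 2)) (i : ℕ)
    (hi : i + 1 ≤ p.length) :
    c (p.getVert i) (p.getVert (i + 1)) = c u p.snd + i := by
  induction i with
  | zero => simp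
  | succ i ih =>
    rw [hc.2 _ _ _ (p.adj_getVert_succ (by lia)) (p.adj_getVert_succ (by lia))
      (hp i (by lia)).symm, ih (by lia)]
    push_cast
    ring

lemma IsCircularColoring.color_penultimate (hc : IsCircularColoring G k c) {u v : V}
    (p : G.Walk u v) (hp : ∀ i, i + 2 ≤ p.length → p.getVert i ≠ p.getVert (i + 2))
    (h : 1 ≤ p.length) : c p.penultimate v + 1 = c u p.snd + p.length := by
  have := hc.color_getVert p hp (p.length - 1) (by lia)
  rw [Nat.sub_add_cancel h, Walk.getVert_length] at this
  rw [Walk.penultimate, this, Nat.cast_sub h]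
  push_cast
  ring

lemma SimpleGraph.Walk.IsPath.getVert_ne_getVert_add_two {u v : V} {p : G.Walk u v}
    (hp : p.IsPath) (i : ℕ) (hi : i + 2 ≤ p.length) : p.getVert i ≠ p.getVert (i + 2) := by
  intro h
  have := hp.getVert_injOn (show i ≤ p.length by lia) (show i + 2 ≤ p.length by lia) h
  lia

lemma IsCircularColoring.dvd_length_of_isCycle (hc : IsCircularColoring G k c) {u : V}
    {p : G.Walk u u} (hp : p.IsCycle) : k ∣ p.length := by
  have hl := hp.three_le_length
  have h1 := hc.color_penultimate p
    (fun i hi ↦ hp.getVert_sub_one_ne_getVert_add_one (i := i + 1) (by lia)) (by lia)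
  have h2 := hc.2 _ _ _ (p.adj_penultimate hp.not_nil) (p.adj_snd hp.not_nil)
    hp.snd_ne_penultimate
  rw [← h2, left_eq_add] at h1
  exact (ZMod.natCast_eq_zero_iff _ _).1 h1

lemma SimpleGraph.three_le_degree_iff [Fintype V] [DecidableRel G.Adj] {v : V} :
    3 ≤ G.degree v ↔
      ∃ x y z, G.Adj v x ∧ G.Adj v y ∧ G.Adj v z ∧ x ≠ y ∧ x ≠ z ∧ y ≠ z := by
  rw [← G.card_neighborFinset_eq_degree, ← Nat.lt_iff_add_one_le, Finset.two_lt_card_iff]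
  simp

lemma IsCircularColoring.color_of_three_le_degree [Fintype V] [DecidableRel G.Adj]
    (hc : IsCircularColoring G k c) {v a b : V} (hv : 3 ≤ G.degree v) (ha : G.Adj v a)
    (hb : G.Adj v b) : c v b = c a v + 1 := by
  by_cases hab : b = a
  · subst hab
    obtain ⟨x, y, hx, hy, hxb, hyb, hxy⟩ :
        ∃ x y, G.Adj v x ∧ G.Adj v y ∧ x ≠ b ∧ y ≠ b ∧ x ≠ y := by
      obtain ⟨x, y, z, hx, hy, hz, hxy, hxz, hyz⟩ := three_le_degree_iff.1 hv
      by_cases h1 : x = b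
      · exact ⟨y, z, hy, hz, by grind, by grind, hyz⟩
      · by_cases h2 : y = b
        · exact ⟨x, z, hx, hz, by grind, by grind, hxz⟩
        · exact ⟨x, y, hx, hy, h1, h2, hxy⟩
    rw [hc.2 x v b hx.symm hb hxb.symm, ← hc.2 x v y hx.symm hy hxy.symm,
      hc.2 b v y hb.symm hy hyb]
  · exact hc.2 a v b ha.symm hb hab

lemma IsCircularColoring.dvd_two_mul_length_of_isPath [Fintype V] [DecidableRel G.Adj]
    (hc : IsCircularColoring G k c) {v w : V} {p : G.Walk v w} (hp : p.IsPath) (hvw : v ≠ w)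
    (hv : 3 ≤ G.degree v) (hw : 3 ≤ G.degree w) : k ∣ 2 * p.length := by
  have hn : ¬ p.Nil := Walk.not_nil_of_ne hvw
  have hl : 1 ≤ p.length := by
    by_contra h
    exact hvw (Walk.eq_of_length_eq_zero (p := p) (by lia))
  have h1 := hc.color_penultimate p hp.getVert_ne_getVert_add_two hl
  have h2 := hc.color_penultimate p.reverse hp.reverse.getVert_ne_getVert_add_two (by simpa)
  rw [Walk.snd_reverse, Walk.penultimate_reverse, Walk.length_reverse] at h2
  have h3 := hc.color_of_three_le_degree hw (p.adj_penultimate hn).symm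
    (p.adj_penultimate hn).symm
  have h4 := hc.color_of_three_le_degree hv (p.adj_snd hn) (p.adj_snd hn)
  rw [← ZMod.natCast_eq_zero_iff]
  push_cast
  linear_combination -h1 - h2 - h3 - h4

end Forward

section Distance

variable {V : Type*} {G : SimpleGraph V}

lemma SimpleGraph.Connected.exists_adj_dist_add_one (hG : G.Connected) {r v : V}
    (h : G.dist r v ≠ 0) : ∃ w, G.Adj v w ∧ G.dist r w + 1 = G.dist r v := by
  obtain ⟨p, hp⟩ := hG.exists_walk_length_eq_dist v r
  rw [G.dist_comm] at h ⊢
  cases p with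
  | nil => simp at h
  | @cons _ w _ hvw q =>
    refine ⟨w, hvw, ?_⟩
    have h1 := G.dist_le q
    have h2 := hG.dist_triangle (u := v) (v := w) (w := r)
    rw [dist_eq_one_iff_adj.2 hvw] at h2
    rw [Walk.length_cons] at hp
    rw [G.dist_comm]
    lia

lemma SimpleGraph.Connected.exists_dist_eq (hG : G.Connected) {r v : V} {n : ℕ}
    (h : n ≤ G.dist r v) : ∃ w, G.dist r w = n := by
  induction h using Nat.decreasingInduction with
  | self => exact ⟨v, rfl⟩
  | of_succ m _ ih =>
    obtain ⟨w, hw⟩ := ih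
    obtain ⟨x, -, hx⟩ := hG.exists_adj_dist_add_one (r := r) (v := w) (by lia)
    exact ⟨x, by lia⟩

lemma SimpleGraph.Connected.dist_le_dist_add_one (hG : G.Connected) {r v w : V}
    (h : G.Adj v w) : G.dist r w ≤ G.dist r v + 1 := by
  simpa [dist_eq_one_iff_adj.2 h] using hG.dist_triangle (u := r) (v := v) (w := w)

/-- Two vertices at equal distance from `r` are joined by a path that descends towards `r`, turns at
a vertex which is `r` or has degree at least 3, and ascends again. -/
lemma SimpleGraph.Connected.exists_isPath_of_dist_eq [Fintype V] [DecidableRel G.Adj]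
    (hG : G.Connected) {k : ℕ} {r : V}
    (hd : ∀ v, 3 ≤ G.degree v → (2 * G.dist r v : ZMod k) = 0) {n : ℕ} {v w : V} (hvw : v ≠ w)
    (hv : G.dist r v = n) (hw : G.dist r w = n) :
    ∃ p : G.Walk v w, p.IsPath ∧ (∀ x ∈ p.support, G.dist r x ≤ n) ∧
      (∀ x y, s(x, y) ∈ p.edges → G.dist r x ≠ G.dist r y) ∧ (p.length : ZMod k) = 2 * n := by
  induction n generalizing v w with
  | zero =>
    rw [hG.dist_eq_zero_iff] at hv hw
    exact absurd (hv.symm.trans hw) hvw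
  | succ n ih =>
    obtain ⟨v', hv', hdv⟩ := hG.exists_adj_dist_add_one (r := r) (v := v) (by lia)
    obtain ⟨w', hw', hdw⟩ := hG.exists_adj_dist_add_one (r := r) (v := w) (by lia)
    obtain ⟨q, hq, hqs, hqe, hql⟩ : ∃ q : G.Walk v' w', q.IsPath ∧
        (∀ x ∈ q.support, G.dist r x ≤ n) ∧
        (∀ x y, s(x, y) ∈ q.edges → G.dist r x ≠ G.dist r y) ∧
        (q.length : ZMod k) = 2 * n := by
      by_cases h : v' = w'
      · subst h
        refine ⟨.nil, .nil, by simp; lia, by simp, ?_⟩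
        obtain rfl : G.dist r v' = n := by lia
        by_cases h0 : G.dist r v' = 0
        · simp [h0]
        · obtain ⟨u, hu, hdu⟩ := hG.exists_adj_dist_add_one h0
          rw [hd v' (three_le_degree_iff.2 ⟨u, v, w, hu, hv'.symm, hw'.symm, by grind, by grind,
            hvw⟩)]
          simp
      · exact ih h (by lia) (by lia)
    refine ⟨.cons hv' (q.concat hw'.symm), ?_, ?_, ?_, ?_⟩
    · rw [Walk.cons_isPath_iff, Walk.concat_isPath_iff, Walk.support_concat, List.mem_append,
        List.mem_singleton]
      refine ⟨⟨hq, fun h ↦ ?_⟩, ?_⟩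
      · have := hqs w h
        lia
      · rintro (h | h)
        · have := hqs v h
          lia
        · exact hvw h
    · intro x hx
      rw [Walk.support_cons, Walk.support_concat, List.mem_cons,
        List.mem_append, List.mem_singleton] at hx
      obtain rfl | h | rfl := hx
      · exact hv.le
      · exact (hqs x h).trans n.le_succ
      · exact hw.le
    · intro x y hxy
      rw [Walk.edges_cons, Walk.edges_concat, List.concat_eq_append, List.mem_cons,
        List.mem_append, List.mem_singleton, Sym2.eq_iff, Sym2.eq_iff] at hxy
      obtain (⟨rfl, rfl⟩ | ⟨rfl, rfl⟩) | h | ⟨rfl, rfl⟩ | ⟨rfl, rfl⟩ := hxy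
      · lia
      · lia
      · exact hqe x y h
      · lia
      · lia
    · rw [Walk.length_cons, Walk.length_concat]
      push_cast
      rw [hql]
      ring

lemma SimpleGraph.Walk.IsCycle.exists_dist_le {u : V} {p : G.Walk u u} (hp : p.IsCycle) (r : V) :
    ∃ v a b, G.Adj v a ∧ G.Adj v b ∧ a ≠ b ∧
      G.dist r a ≤ G.dist r v ∧ G.dist r b ≤ G.dist r v := by
  classical
  obtain ⟨v, hv, hmax⟩ := p.support.toFinset.exists_max_image (G.dist r) ⟨u, by simp⟩
  rw [List.mem_toFinset] at hv
  have hq := hp.rotate hv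
  have hmem : ∀ x ∈ (p.rotate v hv).support, G.dist r x ≤ G.dist r v := fun x hx ↦
    hmax x (by simpa using hx)
  exact ⟨v, _, _, Walk.adj_snd hq.not_nil, (Walk.adj_penultimate hq.not_nil).symm,
    hq.snd_ne_penultimate, hmem _ (Walk.getVert_mem_support _ _),
    hmem _ (Walk.getVert_mem_support _ _)⟩

/-- The colour of a step of `G`: the distance from `r` of its first vertex, negated if the step
leads towards `r`. -/
noncomputable def distColor (G : SimpleGraph V) (k : ℕ) (r v w : V) : ZMod k :=
  if G.dist r w + 1 = G.dist r v then -G.dist r v else G.dist r v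

lemma SimpleGraph.Connected.exists_distColor_eq (hG : G.Connected) {k : ℕ} (hk : 1 ≤ k) {r v : V}
    {N : ℕ} (hN : (N : ZMod k) = 0) (hpos : 0 < N)
    (h : N = 2 * G.dist r v ∨
      N = 2 * G.dist r v + 1 ∧ ∃ w, G.Adj v w ∧ G.dist r v = G.dist r w) (j : ZMod k) :
    ∃ x y, G.Adj x y ∧ distColor G k r x y = j := by
  have : NeZero k := ⟨by lia⟩
  obtain ⟨i, hi, rfl⟩ : ∃ i < N, (i : ZMod k) = j := by
    refine ⟨j.val % N, Nat.mod_lt _ hpos, ?_⟩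
    conv_rhs => rw [← ZMod.natCast_zmod_val j, ← Nat.div_add_mod j.val N]
    push_cast
    rw [hN]
    ring
  have hdown : ∀ m, 1 ≤ m → m ≤ G.dist r v →
      ∃ x y, G.Adj x y ∧ G.dist r x = m ∧ G.dist r y + 1 = m := by
    intro m h1 h2
    obtain ⟨x, hx⟩ := hG.exists_dist_eq h2
    obtain ⟨y, hxy, hy⟩ := hG.exists_adj_dist_add_one (r := r) (v := x) (by lia)
    exact ⟨x, y, hxy, hx, by lia⟩
  unfold distColor
  by_cases h1 : i < G.dist r v
  · obtain ⟨x, y, hxy, hx, hy⟩ := hdown (i + 1) (by lia) (by lia)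
    refine ⟨y, x, hxy.symm, ?_⟩
    rw [if_neg (by lia), show G.dist r y = i by lia]
  · by_cases h2 : N - i ≤ G.dist r v
    · obtain ⟨x, y, hxy, hx, hy⟩ := hdown (N - i) (by lia) h2
      refine ⟨x, y, hxy, ?_⟩
      rw [if_pos (by lia), hx, Nat.cast_sub hi.le, hN]
      ring
    · obtain ⟨w, hw, hd⟩ := (h.resolve_left (by lia)).2
      refine ⟨v, w, hw, ?_⟩
      rw [if_neg (by lia), show i = G.dist r v by lia]

end Distance

section Backward

variable {V : Type*} [Fintype V] {G : SimpleGraph V} [DecidableRel G.Adj] {k : ℕ} {r : V}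

lemma SimpleGraph.Connected.two_mul_dist_add_one_eq_zero (hG : G.Connected)
    (hcyc : ∀ (u : V) (p : G.Walk u u), p.IsCycle → k ∣ p.length)
    (hd : ∀ v, 3 ≤ G.degree v → (2 * G.dist r v : ZMod k) = 0) {v w : V} (h : G.Adj v w)
    (hvw : G.dist r v = G.dist r w) : (2 * G.dist r v + 1 : ZMod k) = 0 := by
  obtain ⟨p, hp, -, he, hl⟩ := hG.exists_isPath_of_dist_eq hd h.ne rfl hvw.symm
  have := hcyc w (.cons h.symm p)
    ((Walk.cons_isCycle_iff _ _).2 ⟨hp, fun hm ↦ he _ _ hm hvw.symm⟩)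
  rw [Walk.length_cons, ← ZMod.natCast_eq_zero_iff] at this
  push_cast at this
  rwa [hl] at this

lemma SimpleGraph.Connected.two_mul_dist_eq_zero (hG : G.Connected)
    (hcyc : ∀ (u : V) (p : G.Walk u u), p.IsCycle → k ∣ p.length)
    (hd : ∀ v, 3 ≤ G.degree v → (2 * G.dist r v : ZMod k) = 0) {v a b : V} (ha : G.Adj v a)
    (hb : G.Adj v b) (hab : a ≠ b) (hda : G.dist r a + 1 = G.dist r v)
    (hdb : G.dist r b + 1 = G.dist r v) : (2 * G.dist r v : ZMod k) = 0 := by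
  obtain ⟨p, hp, hs, -, hl⟩ :=
    hG.exists_isPath_of_dist_eq hd (n := G.dist r a) hab rfl (by lia)
  have hv : v ∉ p.support := fun h ↦ by have := hs v h; lia
  have := hcyc v (.cons ha (p.concat hb.symm)) ((Walk.cons_isCycle_iff _ _).2 ⟨hp.concat hv _, by
    rw [Walk.edges_concat, List.concat_eq_append, List.mem_append, List.mem_singleton]
    rintro (h | h)
    · exact hv (p.fst_mem_support_of_mem_edges h)
    · grind⟩)
  rw [Walk.length_cons, Walk.length_concat, ← ZMod.natCast_eq_zero_iff] at this
  push_cast at this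
  rw [← hda, ← this, hl]
  push_cast
  ring

lemma SimpleGraph.Connected.distColor_step (hG : G.Connected)
    (hcyc : ∀ (u : V) (p : G.Walk u u), p.IsCycle → k ∣ p.length)
    (hd : ∀ v, 3 ≤ G.degree v → (2 * G.dist r v : ZMod k) = 0) {v w z : V} (hvw : G.Adj v w)
    (hwz : G.Adj w z) (hzv : z ≠ v) :
    distColor G k r w z = distColor G k r v w + 1 := by
  have h1 := hG.dist_le_dist_add_one (r := r) hvw
  have h2 := hG.dist_le_dist_add_one (r := r) hvw.symm
  unfold distColor
  obtain h | h | h : G.dist r w = G.dist r v + 1 ∨ G.dist r w + 1 = G.dist r v ∨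
    G.dist r v = G.dist r w := by lia
  · have hc : (G.dist r w : ZMod k) = G.dist r v + 1 := by rw [h]; push_cast; rfl
    rw [if_neg (by lia : ¬ G.dist r w + 1 = G.dist r v)]
    split_ifs with hz
    · have := hG.two_mul_dist_eq_zero hcyc hd hvw.symm hwz hzv.symm h.symm hz
      linear_combination hc - this
    · exact hc
  · have hc : (G.dist r v : ZMod k) = G.dist r w + 1 := by rw [← h]; push_cast; rfl
    rw [if_pos h]
    split_ifs with hz
    · linear_combination hc
    · have : (2 * G.dist r w : ZMod k) = 0 := by
        by_cases h0 : G.dist r w = 0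
        · simp [h0]
        · obtain ⟨u, hu, hdu⟩ := hG.exists_adj_dist_add_one h0
          exact hd w (three_le_degree_iff.2 ⟨u, v, z, hu, hvw.symm, hwz, by grind, by grind,
            hzv.symm⟩)
      linear_combination hc + this
  · have hc := hG.two_mul_dist_add_one_eq_zero hcyc hd hvw.symm h.symm
    rw [if_neg (by lia : ¬ G.dist r w + 1 = G.dist r v), h]
    split_ifs with hz
    · linear_combination -hc
    · have : (2 * G.dist r w : ZMod k) = 0 := by
        have h0 : G.dist r w ≠ 0 := fun h0 ↦ by
          rw [h0] at h
          exact hvw.ne ((hG.dist_eq_zero_iff.1 h).symm.trans (hG.dist_eq_zero_iff.1 h0))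
        obtain ⟨u, hu, hdu⟩ := hG.exists_adj_dist_add_one h0
        exact hd w (three_le_degree_iff.2 ⟨u, v, z, hu, hvw.symm, hwz, by grind, by grind,
          hzv.symm⟩)
      linear_combination this - hc

lemma SimpleGraph.Connected.isCircularColoring_distColor (hG : G.Connected) (hk : 1 ≤ k)
    (hcyc : ∀ (u : V) (p : G.Walk u u), p.IsCycle → k ∣ p.length)
    (hd : ∀ v, 3 ≤ G.degree v → (2 * G.dist r v : ZMod k) = 0)
    (h : (∃ v ≠ r, 3 ≤ G.degree v) ∨ ∃ v a b, G.Adj v a ∧ G.Adj v b ∧ a ≠ b ∧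
      G.dist r a ≤ G.dist r v ∧ G.dist r b ≤ G.dist r v) :
    IsCircularColoring G k (distColor G k r) := by
  refine ⟨?_, fun v w z ↦ hG.distColor_step hcyc hd⟩
  have hr : ∀ v ≠ r, (2 * G.dist r v : ZMod k) = 0 →
      ∀ j : ZMod k, ∃ x y, G.Adj x y ∧ distColor G k r x y = j := by
    intro v hv h0
    have := hG.pos_dist_of_ne hv.symm
    exact hG.exists_distColor_eq hk (v := v) (N := 2 * G.dist r v) (by exact_mod_cast h0)
      (by lia) (.inl rfl)
  have hs : ∀ v w, G.Adj v w → G.dist r v = G.dist r w →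
      ∀ j : ZMod k, ∃ x y, G.Adj x y ∧ distColor G k r x y = j := by
    intro v w hvw h0
    exact hG.exists_distColor_eq hk (v := v) (N := 2 * G.dist r v + 1)
      (by exact_mod_cast hG.two_mul_dist_add_one_eq_zero hcyc hd hvw h0) (by lia)
      (.inr ⟨rfl, w, hvw, h0⟩)
  obtain ⟨v, hv, h3⟩ | ⟨v, a, b, ha, hb, hab, hda, hdb⟩ := h
  · exact hr v hv (hd v h3)
  · by_cases h1 : G.dist r v = G.dist r a
    · exact hs v a ha h1
    by_cases h2 : G.dist r v = G.dist r b
    · exact hs v b hb h2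
    have h3 := hG.dist_le_dist_add_one (r := r) ha.symm
    have h4 := hG.dist_le_dist_add_one (r := r) hb.symm
    refine hr v ?_ (hG.two_mul_dist_eq_zero hcyc hd ha hb hab (by lia) (by lia))
    rintro rfl
    rw [G.dist_self] at h1 hda
    lia

/-- A connected graph of maximum degree at most 2 with a vertex of degree at most 1 is a path. -/
lemma SimpleGraph.Connected.isPathGraph (hG : G.Connected) (h2 : ∀ v, ¬ 3 ≤ G.degree v)
    (hr : G.degree r ≤ 1) : IsPathGraph G := by
  have hinj : ∀ n v w, G.dist r v = n → G.dist r w = n → v = w := by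
    intro n
    induction n with
    | zero =>
      intro v w hv hw
      rw [hG.dist_eq_zero_iff] at hv hw
      exact hv.symm.trans hw
    | succ n ih =>
      intro v w hv hw
      obtain ⟨u, hvu, hu⟩ := hG.exists_adj_dist_add_one (r := r) (v := v) (by lia)
      obtain ⟨u', hwu, hu'⟩ := hG.exists_adj_dist_add_one (r := r) (v := w) (by lia)
      obtain rfl := ih u u' (by lia) (by lia)
      by_contra hvw
      by_cases h0 : G.dist r u = 0
      · obtain rfl := hG.dist_eq_zero_iff.1 h0
        rw [← G.card_neighborFinset_eq_degree, Finset.card_le_one] at hr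
        exact hvw (hr v (by simpa using hvu.symm) w (by simpa using hwu.symm))
      · obtain ⟨x, hx, hdx⟩ := hG.exists_adj_dist_add_one h0
        exact h2 u (three_le_degree_iff.2 ⟨x, v, w, hx, hvu.symm, hwu.symm, by grind, by grind,
          hvw⟩)
  have hlt : ∀ v, G.dist r v < Fintype.card V := by
    intro v
    obtain ⟨p, hp, hl⟩ := hG.exists_path_of_dist r v
    exact hl ▸ hp.length_lt
  let f : V → Fin (Fintype.card V) := fun v ↦ ⟨G.dist r v, hlt v⟩
  have hf : Function.Bijective f :=
    (Fintype.bijective_iff_injective_and_card f).2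
      ⟨fun v w h ↦ hinj _ v w rfl (congrArg Fin.val h).symm, by simp⟩
  refine ⟨Fintype.card V, ⟨⟨Equiv.ofBijective f hf, ?_⟩⟩⟩
  have hdown : ∀ v w, G.dist r v + 1 = G.dist r w → G.Adj v w := by
    intro v w h
    obtain ⟨u, hu, hdu⟩ := hG.exists_adj_dist_add_one (r := r) (v := w) (by lia)
    obtain rfl := hinj _ v u rfl (by lia)
    exact hu.symm
  intro v w
  simp only [Equiv.ofBijective_apply, pathGraph_adj, f]
  constructor
  · rintro (h | h)
    · exact hdown v w h
    · exact (hdown w v h).symm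
  · intro h
    have h3 := hG.dist_le_dist_add_one (r := r) h
    have h4 := hG.dist_le_dist_add_one (r := r) h.symm
    have : G.dist r v ≠ G.dist r w := fun e ↦ h.ne (hinj _ v w rfl e.symm)
    lia

/-- In a connected graph that is not a path and has maximum degree at most 2, some vertex has two
neighbours that are no further from `r`. -/
lemma SimpleGraph.Connected.exists_dist_le (hG : G.Connected) (hpath : ¬ IsPathGraph G)
    (h2 : ∀ v, ¬ 3 ≤ G.degree v) (r : V) :
    ∃ v a b, G.Adj v a ∧ G.Adj v b ∧ a ≠ b ∧
      G.dist r a ≤ G.dist r v ∧ G.dist r b ≤ G.dist r v := by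
  obtain ⟨v, -, hv⟩ := Finset.univ.exists_max_image (G.dist r) ⟨r, Finset.mem_univ r⟩
  have h1 : 1 < G.degree v := not_le.1 fun h ↦ hpath (hG.isPathGraph h2 h)
  rw [← G.card_neighborFinset_eq_degree, Finset.one_lt_card] at h1
  obtain ⟨a, ha, b, hb, hab⟩ := h1
  rw [mem_neighborFinset] at ha hb
  exact ⟨v, a, b, ha, hb, hab, hv a (Finset.mem_univ a), hv b (Finset.mem_univ b)⟩

end Backward

/-- characterisation of circularly `k`-partite graphs which are neither
paths nor extended stars. -/
theorem stmt_3 {V : Type*} [Fintype V] (G : SimpleGraph V) [DecidableRel G.Adj]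
    (hG : G.Connected) (hpath : ¬ IsPathGraph G) (hstar : ¬ IsExtendedStar G)
    (k : ℕ) (hk : 1 ≤ k) :
    CircularlyPartite G k ↔
      ((∀ (u : V) (p : G.Walk u u), p.IsCycle → k ∣ p.length) ∧
       (∀ (v w : V) (p : G.Walk v w), p.IsPath → v ≠ w →
          3 ≤ G.degree v → 3 ≤ G.degree w → k ∣ 2 * p.length)) := by
  constructor
  · rintro ⟨-, c, hc⟩
    exact ⟨fun u p hp ↦ hc.dvd_length_of_isCycle hp,
      fun v w p hp hvw hv hw ↦ hc.dvd_two_mul_length_of_isPath hp hvw hv hw⟩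
  · rintro ⟨hcyc, hbranch⟩
    by_cases h : ∃ r, 3 ≤ G.degree r
    · obtain ⟨r, hr⟩ := h
      refine ⟨hk, _, hG.isCircularColoring_distColor (r := r) hk hcyc ?_ ?_⟩
      · intro v hv
        by_cases hrv : r = v
        · simp [hrv]
        · obtain ⟨p, hp, hl⟩ := hG.exists_path_of_dist r v
          have := hbranch r v p hp hrv hr hv
          rw [hl, ← ZMod.natCast_eq_zero_iff] at this
          exact_mod_cast this
      · by_cases h : ∃ v ≠ r, 3 ≤ G.degree v
        · exact .inl h
        · have hacyc : ¬ G.IsAcyclic := fun hacyc ↦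
            hstar ⟨⟨hG, hacyc⟩, r, hr, fun v hv ↦ by_contra fun hvr ↦ h ⟨v, hvr, hv⟩⟩
          simp only [IsAcyclic, not_forall, not_not] at hacyc
          obtain ⟨u, p, hp⟩ := hacyc
          exact .inr (hp.exists_dist_le r)
    · rw [not_exists] at h
      obtain ⟨r⟩ := hG.nonempty
      exact ⟨hk, _, hG.isCircularColoring_distColor (r := r) hk hcyc
        (fun v hv ↦ absurd hv (h v)) (.inr (hG.exists_dist_le hpath h r))⟩
end

section
/- If G is a connected simple graph which is not an extended star graph and χᵒ(G) > 1 is odd, then the vertex chromatic number χ(G) = 3. -/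
open SimpleGraph Function

/-- A finite graph whose vertices of degree at least three are pairwise nonadjacent is
`3`-colorable: give these one colour, then colour the rest greedily. -/
theorem colorable_three_of_branch_independent {V : Type*} [Fintype V] (G : SimpleGraph V)
    [DecidableRel G.Adj] (h : ∀ v w, G.Adj v w → 3 ≤ G.degree v → ¬ 3 ≤ G.degree w) :
    G.Colorable 3 := by
  classical
  have key : ∀ S : Finset V, ∃ f : V → Fin 3, ∀ v w, (3 ≤ G.degree v ∨ v ∈ S) →
      (3 ≤ G.degree w ∨ w ∈ S) → G.Adj v w → f v ≠ f w := by
    intro S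
    induction S using Finset.induction_on with
    | empty =>
      refine ⟨fun _ => 0, fun v w hv hw hvw => ?_⟩
      simp only [Finset.notMem_empty, or_false] at hv hw
      exact absurd hw (h v w hvw hv)
    | insert a S _ ih =>
      obtain ⟨f, hf⟩ := ih
      by_cases hda : 3 ≤ G.degree a
      · refine ⟨f, fun v w hv hw hvw => hf v w ?_ ?_ hvw⟩
        · rcases hv with hv | hv
          · exact Or.inl hv
          · rcases Finset.mem_insert.1 hv with rfl | hv
            exacts [Or.inl hda, Or.inr hv]
        · rcases hw with hw | hw
          · exact Or.inl hw
          · rcases Finset.mem_insert.1 hw with rfl | hw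
            exacts [Or.inl hda, Or.inr hw]
      · obtain ⟨x, hx⟩ : ∃ x, x ∉ (G.neighborFinset a).image f := by
          by_contra! hall
          have h1 : Finset.univ ⊆ (G.neighborFinset a).image f := fun x _ => hall x
          have h2 := Finset.card_le_card h1
          have h3 := Finset.card_image_le (s := G.neighborFinset a) (f := f)
          rw [card_neighborFinset_eq_degree] at h3
          simp only [Finset.card_univ, Fintype.card_fin] at h2
          omega
        have hx' : ∀ y, G.Adj a y → f y ≠ x := fun y hy hfy =>
          hx (Finset.mem_image.2 ⟨y, by simpa using hy, hfy⟩)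
        refine ⟨update f a x, fun v w hv hw hvw => ?_⟩
        by_cases hva : v = a
        · subst hva
          rw [update_self, update_of_ne hvw.ne']
          exact (hx' w hvw).symm
        · by_cases hwa : w = a
          · subst hwa
            rw [update_self, update_of_ne hva]
            exact hx' v hvw.symm
          · rw [update_of_ne hva, update_of_ne hwa]
            refine hf v w ?_ ?_ hvw
            · simpa [hva] using hv
            · simpa [hwa] using hw
  obtain ⟨f, hf⟩ := key Finset.univ
  exact ⟨Coloring.mk f fun {v w} hvw => hf v w (by simp) (by simp) hvw⟩

/-- At a vertex of degree at least three, the colour also increases by one when backtracking. -/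
theorem IsCircularColoring.backtrack {V : Type*} [Fintype V] {G : SimpleGraph V}
    [DecidableRel G.Adj] {k : ℕ} {c : V → V → ZMod k} (hc : IsCircularColoring G k c) {x y : V}
    (hxy : G.Adj x y) (hy : 3 ≤ G.degree y) : c y x = c x y + 1 := by
  classical
  have h2 : 1 < ((G.neighborFinset y).erase x).card := by
    rw [Finset.card_erase_of_mem (by simpa using hxy.symm), card_neighborFinset_eq_degree]
    omega
  obtain ⟨z, hz, z', hz', hne⟩ := Finset.one_lt_card.1 h2
  simp only [Finset.mem_erase, mem_neighborFinset] at hz hz'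
  rw [hc.2 z' y x hz'.2.symm hxy.symm (Ne.symm hz'.1), ← hc.2 z' y z hz'.2.symm hz.2 hne,
    hc.2 x y z hxy hz.2 hz.1]

theorem CircularlyPartite.le_card {V : Type*} [Fintype V] {G : SimpleGraph V} {k : ℕ}
    (h : CircularlyPartite G k) : k ≤ Fintype.card (V × V) := by
  obtain ⟨hk, c, hc, -⟩ := h
  have : NeZero k := ⟨hk.ne'⟩
  have hs : Surjective fun p : V × V => c p.1 p.2 := fun j => by
    obtain ⟨v, w, -, h⟩ := hc j
    exact ⟨(v, w), h⟩
  simpa only [ZMod.card] using Fintype.card_le_of_surjective _ hs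

theorem bddAbove_circularlyPartite {V : Type*} [Fintype V] (G : SimpleGraph V) :
    BddAbove {k | CircularlyPartite G k} :=
  ⟨_, fun _ h => CircularlyPartite.le_card h⟩

/-- If a bipartite graph has a circular `k`-colouring with `k` odd and a nonempty set of oriented
edges each of which is followed by an edge of the set with the next colour, then the graph is
circularly `k * 2`-partite. -/
theorem IsCircularColoring.circularlyPartite_mul_two {V : Type*} {G : SimpleGraph V} {k : ℕ}
    (hk : Odd k) {c : V → V → ZMod k} (hc : IsCircularColoring G k c) (hG : G.Colorable 2)
    (S : V → V → Prop) (hS : ∃ v w, S v w) (hadj : ∀ v w, S v w → G.Adj v w)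
    (hnext : ∀ v w, S v w → ∃ z, S w z ∧ c w z = c v w + 1) : CircularlyPartite G (k * 2) := by
  obtain ⟨C⟩ := hG
  have hC : ∀ v w, G.Adj v w → (C w : ZMod 2) = (C v : ZMod 2) + 1 := fun v w hvw => by
    have : ∀ a b : ZMod 2, a ≠ b → b = a + 1 := by decide
    exact this _ _ (C.valid hvw)
  have : NeZero (k * 2) := ⟨by have := hk.pos; omega⟩
  let e := ZMod.chineseRemainder (Nat.coprime_two_right.2 hk)
  let c' : V → V → ZMod (k * 2) := fun v w => e.symm (c v w, (C v : ZMod 2))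
  have hstep : ∀ v w z, G.Adj v w → c w z = c v w + 1 → c' w z = c' v w + 1 := by
    intro v w z hvw h
    simp only [c']
    rw [← map_one e.symm, ← map_add, h, hC v w hvw]
    rfl
  refine ⟨by have := hk.pos; omega, c', fun j => ?_, fun v w z hvw hwz hne =>
    hstep v w z hvw (hc.2 v w z hvw hwz hne)⟩
  obtain ⟨v₀, w₀, h₀⟩ := hS
  have hwalk : ∀ n : ℕ, ∃ v w, S v w ∧ c' v w = c' v₀ w₀ + n := by
    intro n
    induction n with
    | zero => exact ⟨v₀, w₀, h₀, by simp⟩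
    | succ n ih =>
      obtain ⟨v, w, hvw, h⟩ := ih
      obtain ⟨z, hz, hcz⟩ := hnext v w hvw
      refine ⟨w, z, hz, ?_⟩
      rw [hstep v w z (hadj v w hvw) hcz, h]
      push_cast
      ring
  obtain ⟨v, w, hvw, h⟩ := hwalk (j - c' v₀ w₀).val
  refine ⟨v, w, hadj v w hvw, ?_⟩
  rw [h, ZMod.natCast_val, ZMod.cast_id]
  ring

/-- A bipartite graph containing a cycle that is circularly `k`-partite with `k` odd is
circularly `k * 2`-partite. -/
theorem IsCircularColoring.circularlyPartite_mul_two_of_not_isAcyclic {V : Type*}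
    {G : SimpleGraph V} {k : ℕ} (hk : Odd k) {c : V → V → ZMod k} (hc : IsCircularColoring G k c)
    (hG : G.Colorable 2) (hcyc : ¬ G.IsAcyclic) : CircularlyPartite G (k * 2) := by
  unfold SimpleGraph.IsAcyclic at hcyc
  push Not at hcyc
  obtain ⟨u, p, hp⟩ := hcyc
  refine hc.circularlyPartite_mul_two hk hG p.toSubgraph.Adj
    ⟨_, _, p.toSubgraph_adj_snd hp.not_nil⟩ (fun v w h => h.adj_sub) fun v w h => ?_
  have h2 := hp.ncard_neighborSet_toSubgraph_eq_two
    (Walk.mem_support_of_adj_toSubgraph h.symm)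
  obtain ⟨z, hz, hne⟩ := Set.exists_ne_of_one_lt_ncard (h2.symm ▸ one_lt_two) v
  exact ⟨z, hz, hc.2 v w z h.adj_sub (Subgraph.Adj.adj_sub hz) hne⟩

/-- A connected bipartite graph with two vertices of degree at least three that is circularly
`k`-partite with `k` odd is circularly `k * 2`-partite. -/
theorem IsCircularColoring.circularlyPartite_mul_two_of_branch {V : Type*} [Fintype V]
    {G : SimpleGraph V} [DecidableRel G.Adj] {k : ℕ} (hk : Odd k) {c : V → V → ZMod k}
    (hc : IsCircularColoring G k c) (hconn : G.Connected) (hG : G.Colorable 2) {a b : V}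
    (hab : a ≠ b) (ha : 3 ≤ G.degree a) (hb : 3 ≤ G.degree b) : CircularlyPartite G (k * 2) := by
  obtain ⟨p, hp⟩ := hconn.exists_isPath a b
  refine hc.circularlyPartite_mul_two hk hG p.toSubgraph.Adj
    ⟨_, _, p.toSubgraph_adj_snd (Walk.not_nil_of_ne hab)⟩ (fun v w h => h.adj_sub)
    fun v w h => ?_
  by_cases hw : 3 ≤ G.degree w
  · exact ⟨v, h.symm, hc.backtrack h.adj_sub hw⟩
  obtain ⟨i, rfl, hi⟩ := Walk.mem_support_iff_exists_getVert.1
    (Walk.mem_support_of_adj_toSubgraph h.symm)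
  have h2 := hp.ncard_neighborSet_toSubgraph_internal_eq_two (i := i)
    (by rintro rfl; exact hw (by rwa [Walk.getVert_zero]))
    (lt_of_le_of_ne hi (by rintro rfl; exact hw (by rwa [Walk.getVert_length])))
  obtain ⟨z, hz, hne⟩ := Set.exists_ne_of_one_lt_ncard (h2.symm ▸ one_lt_two) v
  exact ⟨z, hz, hc.2 v _ z h.adj_sub (Subgraph.Adj.adj_sub hz) hne⟩

/-- In a tree, a vertex has at most one neighbour closer to a given root. -/
theorem SimpleGraph.IsTree.eq_of_adj_of_dist_lt {V : Type*} {G : SimpleGraph V} (hT : G.IsTree)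
    {a v w z : V} (hv : G.Adj v w) (hz : G.Adj z w) (hdv : G.dist a w = G.dist a v + 1)
    (hdz : G.dist a w = G.dist a z + 1) : v = z := by
  obtain ⟨p, hp⟩ := hT.connected.exists_walk_length_eq_dist a v
  obtain ⟨q, hq⟩ := hT.connected.exists_walk_length_eq_dist a z
  have hp' : (p.concat hv).IsPath := Walk.isPath_of_length_eq_dist _ (by simp [hp, hdv])
  have hq' : (q.concat hz).IsPath := Walk.isPath_of_length_eq_dist _ (by simp [hq, hdz])
  have := congrArg Walk.penultimate ((hT.existsUnique_path a w).unique hp' hq')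
  simpa using this

theorem SimpleGraph.Connected.exists_adj_dist_succ {V : Type*} {G : SimpleGraph V}
    (hG : G.Connected) {a v : V} (hne : v ≠ a) : ∃ u, G.Adj u v ∧ G.dist a v = G.dist a u + 1 := by
  obtain ⟨p, hp⟩ := hG.exists_walk_length_eq_dist a v
  have hnil : ¬ p.Nil := Walk.not_nil_of_ne hne.symm
  have hadj := Walk.adj_penultimate hnil
  refine ⟨p.penultimate, hadj, ?_⟩
  have h1 := dist_le p.dropLast
  have h2 := hG.dist_triangle (u := a) (v := p.penultimate) (w := v)
  rw [dist_eq_one_iff_adj.2 hadj] at h2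
  have h3 : p.dropLast.length + 1 = p.length := by
    rw [← Walk.length_concat p.dropLast hadj, Walk.concat_dropLast]
  omega

/-- The oriented edge periodic colouring number of a tree without vertices of degree at least
three (that is, of a path) is not odd. -/
theorem not_odd_chiO_of_degree_le_two {V : Type*} [Fintype V] {G : SimpleGraph V}
    [DecidableRel G.Adj] (hT : G.IsTree) (hdeg : ∀ v, G.degree v ≤ 2)
    (hk : CircularlyPartite G (chiO G)) : ¬ Odd (chiO G) := by
  classical
  intro hodd
  have hnt : Nontrivial V := by
    obtain ⟨-, c, hc, -⟩ := hk
    obtain ⟨v, w, hvw, -⟩ := hc 0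
    exact ⟨v, w, hvw.ne⟩
  obtain ⟨a, ha⟩ := hT.exists_vert_degree_one_of_nontrivial
  have hup : ∀ v w z, G.Adj v w → G.Adj v z → G.dist a w = G.dist a v + 1 →
      G.dist a z = G.dist a v + 1 → w = z := by
    intro v w z hw hz hdw hdz
    by_contra hne
    by_cases hva : v = a
    · subst hva
      have : 1 < (G.neighborFinset v).card :=
        Finset.one_lt_card.2 ⟨w, by simpa using hw, z, by simpa using hz, hne⟩
      rw [card_neighborFinset_eq_degree] at this
      omega
    · obtain ⟨u, hu, hdu⟩ := hT.connected.exists_adj_dist_succ hva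
      have : 2 < (G.neighborFinset v).card := by
        refine Finset.two_lt_card.2 ⟨w, by simpa using hw, z, by simpa using hz, u,
          by simpa using hu.symm, hne, ?_, ?_⟩ <;> rintro rfl <;> omega
      rw [card_neighborFinset_eq_degree] at this
      have := hdeg v
      omega
  have hinj : ∀ n u v, G.dist a u = n → G.dist a v = n → u = v := by
    intro n
    induction n with
    | zero =>
      intro u v hu hv
      rw [← hT.connected.dist_eq_zero_iff.1 hu, ← hT.connected.dist_eq_zero_iff.1 hv]
    | succ n ih =>
      intro u v hu hv
      obtain ⟨u', hu', hdu⟩ := hT.connected.exists_adj_dist_succ (a := a) (v := u)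
        (by rintro rfl; simp at hu)
      obtain ⟨v', hv', hdv⟩ := hT.connected.exists_adj_dist_succ (a := a) (v := v)
        (by rintro rfl; simp at hv)
      obtain rfl := ih u' v' (by omega) (by omega)
      exact hup u' u v hu' hv' hdu hdv
  obtain ⟨b, -, hb⟩ := Finset.exists_max_image Finset.univ (G.dist a) ⟨a, Finset.mem_univ a⟩
  replace hb : ∀ v, G.dist a v ≤ G.dist a b := fun v => hb v (Finset.mem_univ v)
  obtain ⟨M, hM⟩ : ∃ M, G.dist a b = M := ⟨_, rfl⟩
  rw [hM] at hb
  have hlevel : ∀ d ≤ M, ∃ v, G.dist a v = M - d := by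
    intro d
    induction d with
    | zero => exact fun _ => ⟨b, hM⟩
    | succ d ih =>
      intro hd
      obtain ⟨v, hv⟩ := ih (by omega)
      obtain ⟨u, -, hdu⟩ := hT.connected.exists_adj_dist_succ (a := a) (v := v)
        (by rintro rfl; rw [dist_self] at hv; omega)
      exact ⟨u, by omega⟩
  let l : V → V → ℕ := fun v w =>
    if G.dist a w = G.dist a v + 1 then G.dist a v else 2 * M - G.dist a v
  have hstep : ∀ v w, G.Adj v w →
      G.dist a v = G.dist a w + 1 ∧ l v w = 2 * M - G.dist a v ∨
      G.dist a w = G.dist a v + 1 ∧ l v w = G.dist a v := by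
    intro v w hvw
    rcases hT.dist_eq_dist_add_one_of_adj a hvw with h | h
    · exact Or.inl ⟨h, if_neg (by omega)⟩
    · exact Or.inr ⟨h, if_pos h⟩
  have hlt : ∀ v w, G.Adj v w → l v w < 2 * M := by
    intro v w hvw
    have := hb v
    have := hb w
    rcases hstep v w hvw with h | h <;> omega
  have hle : chiO G ≤ 2 * M := by
    obtain ⟨hpos, c, hc, -⟩ := hk
    have : NeZero (chiO G) := ⟨hpos.ne'⟩
    choose s t hst hcst using hc
    have hi : Injective fun j => (⟨l (s j) (t j), hlt _ _ (hst j)⟩ : Fin (2 * M)) := by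
      intro i j hij
      have hij' : l (s i) (t i) = l (s j) (t j) := congrArg Fin.val hij
      have h1 := hb (s i)
      have h2 := hb (s j)
      have h3 := hb (t i)
      have h4 := hb (t j)
      have hs : s i = s j := hinj _ _ _ rfl (by
        rcases hstep _ _ (hst i) with h | h <;> rcases hstep _ _ (hst j) with h' | h' <;> omega)
      have ht : t i = t j := hinj _ _ _ rfl (by
        rcases hstep _ _ (hst i) with h | h <;> rcases hstep _ _ (hst j) with h' | h' <;> omega)
      rw [← hcst i, ← hcst j, hs, ht]
    simpa only [ZMod.card, Fintype.card_fin] using Fintype.card_le_of_injective _ hi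
  have hpos : 0 < 2 * M := hodd.pos.trans_le hle
  have hcol : CircularlyPartite G (2 * M) := by
    have : NeZero (2 * M) := ⟨hpos.ne'⟩
    refine ⟨hpos, fun v w => (l v w : ZMod (2 * M)), fun j => ?_, fun v w z hvw hwz hne => ?_⟩
    · have hj := ZMod.val_lt j
      have hcast := ZMod.natCast_zmod_val j
      obtain ⟨v, hv⟩ := hlevel (if j.val < M then M - (j.val + 1) else j.val - M)
        (by split_ifs <;> omega)
      obtain ⟨u, huv, hu⟩ := hT.connected.exists_adj_dist_succ (a := a) (v := v)
        (by rintro rfl; rw [dist_self] at hv; split_ifs at hv <;> omega)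
      split_ifs at hv with hlt'
      · refine ⟨u, v, huv, ?_⟩
        have hl : l u v = j.val := by rcases hstep u v huv with h | h <;> omega
        simpa only [hl] using hcast
      · refine ⟨v, u, huv.symm, ?_⟩
        have hl : l v u = j.val := by rcases hstep v u huv.symm with h | h <;> omega
        simpa only [hl] using hcast
    · have := hb v
      have := hb w
      have hsucc : l w z = l v w + 1 ∨ l w z = 0 ∧ l v w + 1 = 2 * M := by
        rcases hstep v w hvw with h | h <;> rcases hstep w z hwz with h' | h'
        · omega
        · exact absurd (hup w v z hvw.symm hwz h.1 h'.1) hne.symm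
        · exact absurd (hT.eq_of_adj_of_dist_lt hvw hwz.symm h.1 h'.1) hne.symm
        · omega
      dsimp only
      rcases hsucc with h | ⟨h, h'⟩
      · rw [h]
        push_cast
        rfl
      · rw [h, ← Nat.cast_succ, Nat.succ_eq_add_one, h']
        simp
  have hge : 2 * M ≤ chiO G := le_csSup (bddAbove_circularlyPartite G) hcol
  obtain ⟨m, hm⟩ := hodd
  omega

/-- if `G` is connected, not an extended star, and `χᵒ(G) > 1` is odd,
then `χ(G) = 3`. -/
theorem stmt_10 {V : Type*} [Fintype V] (G : SimpleGraph V) [DecidableRel G.Adj]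
    (hG : G.Connected) (hstar : ¬ IsExtendedStar G)
    (hodd : Odd (chiO G)) (hgt : 1 < chiO G) :
    G.chromaticNumber = 3 := by
  have hk : CircularlyPartite G (chiO G) := by
    refine Nat.sSup_mem ?_ (bddAbove_circularlyPartite G)
    by_contra hempty
    rw [Set.not_nonempty_iff_eq_empty] at hempty
    simp [chiO, hempty] at hgt
  have hmax : ¬ CircularlyPartite G (chiO G * 2) := fun h => by
    have : chiO G * 2 ≤ chiO G := le_csSup (bddAbove_circularlyPartite G) h
    omega
  obtain ⟨-, c, hc⟩ := id hk
  have h3 : G.Colorable 3 := by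
    refine colorable_three_of_branch_independent G fun v w hvw hv hw => ?_
    have h1 := hc.backtrack hvw hw
    rw [hc.backtrack hvw.symm hv, add_assoc, left_eq_add] at h1
    have h2 : ((2 : ℕ) : ZMod (chiO G)) = 0 := by
      rw [← h1]
      norm_num
    have := Nat.le_of_dvd two_pos ((ZMod.natCast_eq_zero_iff _ _).1 h2)
    obtain ⟨m, hm⟩ := hodd
    omega
  have h2 : ¬ G.Colorable 2 := by
    intro h2
    have hac : G.IsAcyclic := by
      by_contra hcyc
      exact hmax (hc.circularlyPartite_mul_two_of_not_isAcyclic hodd h2 hcyc)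
    have hT : G.IsTree := ⟨hG, hac⟩
    by_cases hbranch : ∃ v, 3 ≤ G.degree v
    · obtain ⟨v, hv⟩ := hbranch
      refine hstar ⟨hT, v, hv, fun w hw => ?_⟩
      by_contra hne
      exact hmax (hc.circularlyPartite_mul_two_of_branch hodd hG h2 hne hw hv)
    · push Not at hbranch
      exact not_odd_chiO_of_degree_le_two hT (fun v => Nat.le_of_lt_succ (hbranch v)) hk hodd
  exact chromaticNumber_eq_iff_colorable_not_colorable.2 ⟨h3, h2⟩
end

section
/- Let G be a connected simple graph with minimum degree ≥ 2 which is not a cycle graph, fix t ≥ 3 not larger than the shortest cycle length of G, and let τ = ⌊t/2⌋. Then χ_t(G) = τ + 1 if and only if G is circularly t-partite. -/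
open SimpleGraph Function

section NonBacktracking

variable {V : Type*} {G : SimpleGraph V}

/-- An infinite non-backtracking walk in `G`. -/
def IsRay (G : SimpleGraph V) (s : ℕ → V) : Prop :=
  ∀ i, G.Adj (s i) (s (i + 1)) ∧ s i ≠ s (i + 2)

theorem IsRay.shift {s : ℕ → V} (hs : IsRay G s) (m : ℕ) : IsRay G (fun i => s (m + i)) :=
  fun i => hs (m + i)

theorem IsRay.exists_isPath {s : ℕ → V} (hs : IsRay G s) (n : ℕ)
    (hinj : ∀ i j, i < j → j ≤ n → s i ≠ s j) :
    ∃ p : G.Walk (s 0) (s n), p.IsPath ∧ p.length = n ∧ ∀ x ∈ p.support, ∃ i ≤ n, x = s i := by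
  induction n generalizing s with
  | zero => exact ⟨.nil, by simp, by simp, fun x hx => ⟨0, le_rfl, by simpa using hx⟩⟩
  | succ n ih =>
    obtain ⟨p, hp, hlen, hsup⟩ := ih (s := fun i => s (i + 1)) (fun i => hs (i + 1))
      fun i j hij hj => hinj _ _ (by omega) (by omega)
    refine ⟨.cons (hs 0).1 p, ?_, by simp [hlen], ?_⟩
    · rw [Walk.cons_isPath_iff]
      refine ⟨hp, fun h => ?_⟩
      obtain ⟨i, hi, h⟩ := hsup _ h
      exact hinj 0 (i + 1) (by omega) (by omega) h
    · intro x hx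
      rw [Walk.support_cons, List.mem_cons] at hx
      rcases hx with rfl | hx
      · exact ⟨0, by omega, rfl⟩
      · obtain ⟨i, hi, h⟩ := hsup _ hx
        exact ⟨i + 1, by omega, h⟩

theorem IsRay.ne_of_lt_egirth (d : ℕ) {s : ℕ → V} (hs : IsRay G s)
    (hd : 0 < d) (hlt : (d : ℕ∞) < G.egirth) : s 0 ≠ s d := by
  induction d using Nat.strong_induction_on generalizing s with
  | _ d ih =>
  intro heq
  obtain rfl | rfl | hd3 : d = 1 ∨ d = 2 ∨ 3 ≤ d := by omega
  · exact (hs 0).1.ne heq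
  · exact (hs 0).2 heq
  obtain ⟨n, rfl⟩ : ∃ n, d = n + 1 := ⟨d - 1, by omega⟩
  obtain ⟨p, hp, hlen, -⟩ := (hs.shift 1).exists_isPath n fun i j hij hj => by
    have := ih (j - i) (by omega) ((hs.shift 1).shift i) (by omega)
      (lt_of_le_of_lt (by exact_mod_cast (by omega : j - i ≤ n + 1)) hlt)
    simpa [Nat.add_sub_cancel' hij.le] using this
  have hadj : G.Adj (s (1 + n)) (s (1 + 0)) := by
    rw [add_comm 1 n, ← heq]; exact (hs 0).1
  have hcyc : (Walk.cons hadj p).IsCycle := by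
    rw [Walk.cons_isCycle_iff]
    refine ⟨hp, fun h => ?_⟩
    have := hp.length_eq_one_of_mem_edges (Sym2.eq_swap ▸ h)
    omega
  have := egirth_le_length hcyc
  rw [Walk.length_cons, hlen] at this
  exact absurd hlt (not_lt.2 this)

theorem IsRay.cons {s : ℕ → V} (hs : IsRay G s) {x : V} (hx : G.Adj x (s 0)) (hne : x ≠ s 1) :
    ∃ r : ℕ → V, IsRay G r ∧ r 0 = x ∧ ∀ i, r (i + 1) = s i := by
  refine ⟨fun i => Nat.casesOn i x s, fun i => ?_, rfl, fun i => rfl⟩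
  cases i with
  | zero => exact ⟨hx, hne⟩
  | succ i => exact hs i

theorem exists_isRay (hext : ∀ u w, ∃ z, G.Adj w z ∧ z ≠ u) {u w : V} (h : G.Adj u w) :
    ∃ s, IsRay G s ∧ s 0 = u ∧ s 1 = w := by
  choose f hf hne using hext
  let e : ℕ → V × V := fun n => (fun q : V × V => (q.2, f q.1 q.2))^[n] (u, w)
  have hsucc : ∀ n, e (n + 1) = ((e n).2, f (e n).1 (e n).2) := fun n =>
    Function.iterate_succ_apply' _ _ _
  have hadj : ∀ n, G.Adj (e n).1 (e n).2 := by
    intro n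
    induction n with
    | zero => exact h
    | succ n ih => rw [hsucc]; exact hf _ _
  refine ⟨fun n => (e n).1, fun i => ⟨?_, ?_⟩, rfl, ?_⟩
  · simpa only [hsucc] using hadj i
  · simpa only [hsucc] using (hne (e i).1 (e i).2).symm
  · simp only [hsucc 0]; rfl

theorem IsRay.glue {a b : ℕ → V} (ha : IsRay G a) (hb : IsRay G b) (h0 : a 0 = b 0)
    (h1 : a 1 ≠ b 1) (n : ℕ) :
    IsRay G (fun k => if k ≤ n then a (n - k) else b (k - n)) := by
  intro k
  obtain hk | hk | hk | hk : k + 2 ≤ n ∨ k + 1 = n ∨ k = n ∨ n < k := by omega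
  · obtain ⟨m, rfl⟩ := Nat.exists_eq_add_of_le hk
    simp only [show k ≤ k + 2 + m by omega, show k + 1 ≤ k + 2 + m by omega, hk, if_true,
      show k + 2 + m - k = m + 2 by omega, show k + 2 + m - (k + 1) = m + 1 by omega,
      show k + 2 + m - (k + 2) = m by omega]
    exact ⟨(ha (m + 1)).1.symm, (ha m).2.symm⟩
  · subst hk
    simpa using ⟨(ha 0).1.symm, h1⟩
  · subst hk
    have := hb 0
    simpa [h0] using this
  · obtain ⟨m, rfl⟩ := Nat.exists_eq_add_of_lt hk
    have := hb (m + 1)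
    simpa [show ¬ n + m + 1 ≤ n by omega, show ¬ n + m + 1 + 1 ≤ n by omega,
      show ¬ n + m + 1 + 2 ≤ n by omega, show n + m + 1 - n = m + 1 by omega,
      show n + m + 1 + 1 - n = m + 1 + 1 by omega,
      show n + m + 1 + 2 - n = m + 1 + 2 by omega] using this

theorem IsRay.exists_reverse (hext : ∀ u w, ∃ z, G.Adj w z ∧ z ≠ u) {a : ℕ → V}
    (ha : IsRay G a) (n : ℕ) : ∃ b, IsRay G b ∧ b 0 = a n ∧ b n = a 0 := by
  obtain ⟨z, hz, hne⟩ := hext (a 1) (a 0)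
  obtain ⟨r, hr, hr0, hr1⟩ := exists_isRay hext hz
  exact ⟨_, ha.glue hr hr0.symm (hr1 ▸ hne.symm) n, by simp, by simp⟩

theorem exists_isRay_to (hG : G.Connected) (hext : ∀ u w, ∃ z, G.Adj w z ∧ z ≠ u) (v w : V) :
    w = v ∨ ∃ a n, IsRay G a ∧ 1 ≤ n ∧ a 0 = w ∧ a n = v := by
  obtain ⟨p⟩ := hG.preconnected w v
  induction p with
  | nil => exact .inl rfl
  | @cons w w' v h p ih =>
    rcases ih with rfl | ⟨a, n, ha, hn, rfl, rfl⟩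
    · obtain ⟨s, hs, h0, h1⟩ := exists_isRay hext h
      exact .inr ⟨s, 1, hs, le_rfl, h0, h1⟩
    · by_cases hw : w = a 1
      · subst hw
        obtain rfl | hn2 : n = 1 ∨ 2 ≤ n := by omega
        · exact .inl rfl
        · exact .inr ⟨_, n - 1, ha.shift 1, by omega, rfl, by simp [show 1 + (n - 1) = n by omega]⟩
      · obtain ⟨r, hr, hr0, hr1⟩ := ha.cons h hw
        exact .inr ⟨r, n + 1, hr, by omega, hr0, hr1 n⟩

theorem IsPeriodicColoring.apply_isRay {C : Type*} {t : ℕ} {κ : V → C}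
    (hκ : IsPeriodicColoring G t κ) (hgirth : (t : ℕ∞) ≤ G.egirth) {s : ℕ → V}
    (hs : IsRay G s) : κ (s 0) = κ (s t) := by
  by_cases h : s 0 = s t
  · rw [h]
  obtain ⟨p, hp, hlen, -⟩ := hs.exists_isPath t fun i j hij hj => by
    obtain hlt | heq : j - i < t ∨ j - i = t := by omega
    · have := (hs.shift i).ne_of_lt_egirth (j - i) (by omega)
        (lt_of_lt_of_le (by exact_mod_cast hlt) hgirth)
      simpa [Nat.add_sub_cancel' hij.le] using this
    · obtain ⟨rfl, rfl⟩ : i = 0 ∧ j = t := by omega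
      exact h
  exact hκ _ _ p hp hlen

theorem IsPeriodicColoring.apply_isRay_add_mul {C : Type*} {t : ℕ} {κ : V → C}
    (hκ : IsPeriodicColoring G t κ) (hgirth : (t : ℕ∞) ≤ G.egirth) {s : ℕ → V}
    (hs : IsRay G s) (m : ℕ) : κ (s 0) = κ (s (t * m)) := by
  induction m with
  | zero => simp
  | succ m ih => rw [ih, mul_add, mul_one]; exact hκ.apply_isRay hgirth (hs.shift (t * m))

theorem IsPeriodicColoring.apply_eq_of_dvd_of_ne {C : Type*} {t : ℕ} {κ : V → C}
    (hκ : IsPeriodicColoring G t κ) (hgirth : (t : ℕ∞) ≤ G.egirth) {a b : ℕ → V}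
    (ha : IsRay G a) (hb : IsRay G b) (h0 : a 0 = b 0) (h1 : a 1 ≠ b 1) {i j : ℕ}
    (hij : t ∣ i + j) : κ (a i) = κ (b j) := by
  obtain ⟨m, hm⟩ := hij
  have := hκ.apply_isRay_add_mul hgirth (ha.glue hb h0 h1 i) m
  rw [← hm] at this
  rcases Nat.eq_zero_or_pos j with rfl | hj
  · simpa [h0] using this
  · simpa [show ¬ i + j ≤ i by omega] using this

/-- Along rays issued from a branch vertex, a periodic colouring depends only on the distance. -/
theorem IsPeriodicColoring.apply_eq_of_branch {C : Type*} {t : ℕ} {κ : V → C}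
    (hκ : IsPeriodicColoring G t κ) (hgirth : (t : ℕ∞) ≤ G.egirth) (ht : 1 ≤ t)
    (hext : ∀ u w, ∃ z, G.Adj w z ∧ z ≠ u) {a b : ℕ → V}
    (ha : IsRay G a) (hb : IsRay G b) (h0 : a 0 = b 0)
    (hbr : ∀ x y, ∃ z, G.Adj (a 0) z ∧ z ≠ x ∧ z ≠ y) (i : ℕ) : κ (a i) = κ (b i) := by
  obtain ⟨z, hz, hza, hzb⟩ := hbr (a 1) (b 1)
  obtain ⟨d, hd, hd0, hd1⟩ := exists_isRay hext hz
  subst hd1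
  have hdvd : t ∣ i + (t - 1) * i := ⟨i, by
    obtain ⟨m, rfl⟩ := Nat.exists_eq_add_of_le ht; simp; ring⟩
  rw [hκ.apply_eq_of_dvd_of_ne hgirth ha hd hd0.symm hza.symm hdvd,
    hκ.apply_eq_of_dvd_of_ne hgirth hb hd (h0.symm.trans hd0.symm) hzb.symm hdvd]

theorem IsPeriodicColoring.apply_eq_of_branch_of_dvd {C : Type*} {t : ℕ} {κ : V → C}
    (hκ : IsPeriodicColoring G t κ) (hgirth : (t : ℕ∞) ≤ G.egirth) (ht : 1 ≤ t)
    (hext : ∀ u w, ∃ z, G.Adj w z ∧ z ≠ u) {a : ℕ → V} (ha : IsRay G a)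
    (hbr : ∀ x y, ∃ z, G.Adj (a 0) z ∧ z ≠ x ∧ z ≠ y) {i j : ℕ} (hij : t ∣ i + j) :
    κ (a i) = κ (a j) := by
  obtain ⟨z, hz, hza, -⟩ := hbr (a 1) (a 1)
  obtain ⟨d, hd, hd0, hd1⟩ := exists_isRay hext hz
  subst hd1
  rw [hκ.apply_eq_of_dvd_of_ne hgirth ha hd hd0.symm hza.symm hij]
  exact hκ.apply_eq_of_branch hgirth ht hext hd ha hd0 (hd0 ▸ hbr) j

theorem IsCircularColoring.apply_getVert {t : ℕ} {c : V → V → ZMod t}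
    (hc : IsCircularColoring G t c) {u v : V} {p : G.Walk u v} (hp : p.IsPath) (n : ℕ)
    (hn : n < p.length) :
    c (p.getVert n) (p.getVert (n + 1)) = c (p.getVert 0) (p.getVert 1) + n := by
  induction n with
  | zero => simp
  | succ n ih =>
    rw [hc.2 (p.getVert n) _ _ (p.adj_getVert_succ (by omega)) (p.adj_getVert_succ hn) fun h => ?_,
      ih (by omega)]
    · push_cast; ring
    · have := hp.getVert_injOn (by simp only [Set.mem_ofPred_eq]; omega)
        (by simp only [Set.mem_ofPred_eq]; omega) h
      omega

end NonBacktracking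

section Branch

variable {V : Type*} [Fintype V] {G : SimpleGraph V} [DecidableRel G.Adj]

theorem exists_adj_ne (hmin : ∀ v : V, 2 ≤ G.degree v) (u w : V) : ∃ z, G.Adj w z ∧ z ≠ u := by
  obtain ⟨z, hz, hne⟩ := Finset.exists_mem_ne (s := G.neighborFinset w) (hmin w) u
  exact ⟨z, by simpa using hz, hne⟩

theorem exists_adj_ne_ne {w : V} (hw : 3 ≤ G.degree w) (x y : V) :
    ∃ z, G.Adj w z ∧ z ≠ x ∧ z ≠ y := by
  classical
  by_contra! h
  have : G.neighborFinset w ⊆ {x, y} := fun z hz => by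
    have := h z (by simpa using hz)
    simp only [Finset.mem_insert, Finset.mem_singleton]
    tauto
  have := (Finset.card_le_card this).trans Finset.card_le_two
  rw [card_neighborFinset_eq_degree] at this
  omega

theorem three_le_degree_of_adj {w x y z : V} (hx : G.Adj w x) (hy : G.Adj w y) (hz : G.Adj w z)
    (hxy : x ≠ y) (hxz : x ≠ z) (hyz : y ≠ z) : 3 ≤ G.degree w := by
  classical
  rw [← card_neighborFinset_eq_degree, ← Finset.card_eq_three.2 ⟨x, y, z, hxy, hxz, hyz, rfl⟩]
  refine Finset.card_le_card fun u hu => ?_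
  simp only [Finset.mem_insert, Finset.mem_singleton] at hu
  rcases hu with rfl | rfl | rfl <;> simpa

theorem not_isAcyclic_of_two_le_degree [Nonempty V] (hmin : ∀ v : V, 2 ≤ G.degree v) :
    ¬ G.IsAcyclic := by
  intro hac
  obtain ⟨v⟩ := ‹Nonempty V›
  obtain ⟨w, hw, -⟩ := exists_adj_ne hmin v v
  obtain ⟨s, hs, -, -⟩ := exists_isRay (exists_adj_ne hmin) hw
  obtain ⟨i, j, hne, h⟩ := Finite.exists_ne_map_eq_of_infinite s
  wlog hij : i < j generalizing i j
  · exact this j i hne.symm h.symm (by omega)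
  have := (hs.shift i).ne_of_lt_egirth (j - i) (by omega)
    (by rw [hac.egirth_eq_top]; exact ENat.natCast_lt_top _)
  simp [Nat.add_sub_cancel' hij.le, h] at this

theorem exists_iso_cycleGraph (hG : G.Connected) (hdeg : ∀ v : V, G.degree v = 2) :
    ∃ n, Nonempty (G ≃g cycleGraph n) := by
  classical
  have := hG.nonempty
  have hac := not_isAcyclic_of_two_le_degree fun v => (hdeg v).ge
  rw [isAcyclic_iff_free_cycleGraph] at hac
  push Not at hac
  obtain ⟨n, hn, hfree⟩ := hac
  obtain ⟨m, rfl⟩ : ∃ m, n = m + 3 := ⟨n - 3, by omega⟩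
  obtain ⟨f⟩ : cycleGraph (m + 3) ⊑ G := by simpa [Free] using hfree
  have hinj : Injective f := f.injective
  have hnb : ∀ i, ((cycleGraph (m + 3)).neighborFinset i).image f = G.neighborFinset (f i) := by
    intro i
    refine Finset.eq_of_subset_of_card_le ?_ ?_
    · intro x hx
      simp only [Finset.mem_image, mem_neighborFinset] at hx ⊢
      obtain ⟨j, hj, rfl⟩ := hx
      exact f.toHom.map_adj hj
    · rw [Finset.card_image_of_injective _ hinj, card_neighborFinset_eq_degree,
        card_neighborFinset_eq_degree, hdeg, cycleGraph_degree_three_le]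
  have hsurj : Function.Surjective f := by
    intro w
    obtain ⟨p⟩ := hG.preconnected w (f 0)
    generalize hx : f 0 = x at p
    induction p with
    | nil => exact ⟨0, hx⟩
    | cons h p ih =>
      obtain ⟨i, rfl⟩ := ih hx
      have := (mem_neighborFinset G _ _).2 h.symm
      rw [← hnb] at this
      obtain ⟨j, -, hj⟩ := Finset.mem_image.1 this
      exact ⟨j, hj⟩
  refine ⟨m + 3, ⟨(RelIso.symm ⟨Equiv.ofBijective f ⟨hinj, hsurj⟩, ?_⟩)⟩⟩
  intro i j
  refine ⟨fun h => ?_, fun h => f.toHom.map_adj h⟩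
  have := (mem_neighborFinset G _ _).2 h
  change f j ∈ G.neighborFinset (f i) at this
  rw [← hnb] at this
  obtain ⟨k, hk, hkj⟩ := Finset.mem_image.1 this
  rw [hinj hkj] at hk
  simpa using hk

theorem exists_three_le_degree (hG : G.Connected) (hmin : ∀ v : V, 2 ≤ G.degree v)
    (hnotcyc : ¬ ∃ n, Nonempty (G ≃g cycleGraph n)) : ∃ v : V, 3 ≤ G.degree v := by
  by_contra! h
  exact hnotcyc (exists_iso_cycleGraph hG fun v => le_antisymm (by have := h v; omega) (hmin v))

end Branch

section Colorings

variable {V : Type*} [Fintype V] {G : SimpleGraph V} [DecidableRel G.Adj]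

/-- A periodic colouring is read off, along non-backtracking walks, from an even function on
`ZMod t`. -/
theorem IsPeriodicColoring.exists_profile {C : Type*} {t : ℕ} [NeZero t] {κ : V → C}
    (hκ : IsPeriodicColoring G t κ) (hgirth : (t : ℕ∞) ≤ G.egirth)
    (hG : G.Connected) (hmin : ∀ v : V, 2 ≤ G.degree v) {v : V} (hv : 3 ≤ G.degree v) :
    ∃ F : ZMod t → C, (∀ x, F (-x) = F x) ∧
      ∀ u w z, G.Adj u w → G.Adj w z → z ≠ u →
        ∃ d, κ u = F (d - 1) ∧ κ w = F d ∧ κ z = F (d + 1) := by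
  have ht : 1 ≤ t := NeZero.one_le
  have hext := exists_adj_ne hmin
  obtain ⟨x, hx, -⟩ := hext v v
  obtain ⟨b, hb, rfl, -⟩ := exists_isRay hext hx
  have hbr := fun x y => exists_adj_ne_ne hv x y
  have hsym : ∀ i j, t ∣ i + j → κ (b i) = κ (b j) := fun i j h =>
    hκ.apply_eq_of_branch_of_dvd hgirth ht hext hb hbr h
  have hdvd : ∀ i j : ℕ, (i : ZMod t) = -j → κ (b i) = κ (b j) := fun i j h =>
    hsym i j ((ZMod.natCast_eq_zero_iff _ _).1 (by push_cast; rw [h]; ring))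
  have hmod : ∀ i j : ℕ, (i : ZMod t) = j → κ (b i) = κ (b j) := fun i j h =>
    (hdvd i (-(i : ZMod t)).val (by simp)).trans (hdvd _ j (by simp [h]))
  have hray : ∀ a n, IsRay G a → a n = b 0 → κ (a 0) = κ (b n) := by
    intro a n ha han
    obtain ⟨r, hr, hr0, hrn⟩ := ha.exists_reverse hext n
    rw [← hrn]
    exact (hκ.apply_eq_of_branch hgirth ht hext hb hr (hr0.trans han).symm hbr n).symm
  refine ⟨fun x => κ (b x.val), fun x => hdvd _ _ (by simp), ?_⟩
  have hF : ∀ (x : ZMod t) (n : ℕ), x = n → κ (b n) = κ (b x.val) := fun x n h =>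
    hmod _ _ (by simp [h])
  have hF' : ∀ (x : ZMod t) (n : ℕ), x = -n → κ (b n) = κ (b x.val) := fun x n h =>
    hdvd _ _ (by simp [h])
  have hnbr : ∀ w p q, 3 ≤ G.degree w → G.Adj w p → G.Adj w q → κ p = κ q := by
    intro w p q hw hp hq
    obtain ⟨r, hr, rfl, rfl⟩ := exists_isRay hext hp
    obtain ⟨s, hs, hs0, rfl⟩ := exists_isRay hext hq
    exact hκ.apply_eq_of_branch hgirth ht hext hr hs hs0.symm (exists_adj_ne_ne hw) 1
  intro u w z huw hwz hzu
  rcases exists_isRay_to hG hext (b 0) w with rfl | ⟨a, n, ha, hn, rfl, han⟩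
  · refine ⟨0, ?_, hF _ _ (by simp), ?_⟩
    · exact (hnbr _ _ _ hv huw.symm (hb 0).1).trans (hF' _ 1 (by simp))
    · exact (hnbr _ _ _ hv hwz (hb 0).1).trans (hF _ 1 (by simp))
  · have h0 := hray a n ha han
    have h1 : κ (a 1) = κ (b (n - 1)) :=
      hray _ (n - 1) (ha.shift 1) (by simpa [show 1 + (n - 1) = n by omega] using han)
    have hz : ∀ z, G.Adj (a 0) z → z ≠ a 1 → κ z = κ (b (n + 1)) := by
      intro z hz hne
      obtain ⟨r, hr, rfl, hr1⟩ := ha.cons hz.symm hne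
      exact hray r (n + 1) hr ((hr1 n).trans han)
    by_cases hza : z = a 1
    · subst hza
      refine ⟨-n, ?_, ?_, ?_⟩
      · rw [hz u huw.symm hzu.symm]; exact hF' _ _ (by push_cast; ring)
      · rw [h0]; exact hF' _ _ rfl
      · rw [h1]; exact hF' _ _ (by push_cast [hn]; ring)
    · refine ⟨n, ?_, ?_, ?_⟩
      · have : κ u = κ (a 1) := by
          by_cases hua : u = a 1
          · rw [hua]
          · exact hnbr (a 0) _ _
              (three_le_degree_of_adj huw.symm hwz (ha 0).1 hzu.symm hua hza) huw.symm (ha 0).1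
        rw [this, h1]; exact hF _ _ (by push_cast [hn]; ring)
      · rw [h0]; exact hF _ _ rfl
      · rw [hz z hwz hza]; exact hF _ _ (by push_cast; ring)

theorem apply_natAbs_valMinAbs {C : Type*} {t : ℕ} [NeZero t] {F : ZMod t → C}
    (hF : ∀ x, F (-x) = F x) (x : ZMod t) : F (x.valMinAbs.natAbs : ZMod t) = F x := by
  rw [ZMod.natCast_natAbs_valMinAbs]
  split_ifs
  · rfl
  · exact hF x

theorem surjective_of_even {C : Type*} {t : ℕ} [NeZero t] {F : ZMod t → C}
    (hF : ∀ x, F (-x) = F x) (hsurj : Surjective F) :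
    Surjective fun i : Fin (t / 2 + 1) => F (i : ℕ) := by
  intro y
  obtain ⟨x, rfl⟩ := hsurj y
  exact ⟨⟨_, Nat.lt_succ_of_le x.natAbs_valMinAbs_le⟩, apply_natAbs_valMinAbs hF x⟩

theorem eq_or_eq_neg_of_even {t : ℕ} [NeZero t] {F : ZMod t → Fin (t / 2 + 1)}
    (hF : ∀ x, F (-x) = F x) (hsurj : Surjective F) {x y : ZMod t} (h : F x = F y) :
    x = y ∨ x = -y := by
  have hinj := Finite.injective_iff_surjective.2 (surjective_of_even hF hsurj)
  rw [← apply_natAbs_valMinAbs hF x, ← apply_natAbs_valMinAbs hF y] at h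
  have := @hinj ⟨_, Nat.lt_succ_of_le x.natAbs_valMinAbs_le⟩
    ⟨_, Nat.lt_succ_of_le y.natAbs_valMinAbs_le⟩ h
  exact ZMod.natAbs_valMinAbs_eq_natAbs_valMinAbs.1 (Fin.mk.inj this)

theorem surjective_of_profile {C : Type*} {t : ℕ} {κ : V → C} (hmin : ∀ v : V, 2 ≤ G.degree v)
    (hκ : Surjective κ) {F : ZMod t → C}
    (hF : ∀ u w z, G.Adj u w → G.Adj w z → z ≠ u →
      ∃ d, κ u = F (d - 1) ∧ κ w = F d ∧ κ z = F (d + 1)) : Surjective F := by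
  intro y
  obtain ⟨w, rfl⟩ := hκ y
  obtain ⟨u, hu, -⟩ := exists_adj_ne hmin w w
  obtain ⟨z, hz, hne⟩ := exists_adj_ne hmin u w
  obtain ⟨d, -, hd, -⟩ := hF u w z hu.symm hz hne
  exact ⟨d, hd.symm⟩

theorem IsPeriodicColoring.card_le {t k : ℕ} [NeZero t] {κ : V → Fin k}
    (hκ : IsPeriodicColoring G t κ) (hsurj : Surjective κ) (hgirth : (t : ℕ∞) ≤ G.egirth)
    (hG : G.Connected) (hmin : ∀ v : V, 2 ≤ G.degree v) {v : V} (hv : 3 ≤ G.degree v) :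
    k ≤ t / 2 + 1 := by
  obtain ⟨F, heven, hF⟩ := hκ.exists_profile hgirth hG hmin hv
  simpa using Fintype.card_le_of_surjective _
    (surjective_of_even heven (surjective_of_profile hmin hsurj hF))

theorem exists_circular_class {t : ℕ} [NeZero t] (hmin : ∀ v : V, 2 ≤ G.degree v) [Nonempty V]
    {c : V → V → ZMod t}
    (hc : ∀ v w z, G.Adj v w → G.Adj w z → z ≠ v → c w z = c v w + 1) (j : ZMod t) :
    ∃ v w, G.Adj v w ∧ c v w = j := by
  obtain ⟨v⟩ := ‹Nonempty V›
  obtain ⟨w, hw, -⟩ := exists_adj_ne hmin v v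
  have key : ∀ n : ℕ, ∃ x y, G.Adj x y ∧ c x y = c v w + n := by
    intro n
    induction n with
    | zero => exact ⟨v, w, hw, by simp⟩
    | succ n ih =>
      obtain ⟨x, y, hxy, h⟩ := ih
      obtain ⟨z, hz, hne⟩ := exists_adj_ne hmin x y
      exact ⟨y, z, hz, by rw [hc x y z hxy hz hne, h]; push_cast; ring⟩
  obtain ⟨x, y, hxy, h⟩ := key (j - c v w).val
  exact ⟨x, y, hxy, by simpa using h⟩

theorem IsPeriodicColoring.circularlyPartite {t : ℕ} (ht : 3 ≤ t) {κ : V → Fin (t / 2 + 1)}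
    (hκ : IsPeriodicColoring G t κ) (hsurj : Surjective κ) (hgirth : (t : ℕ∞) ≤ G.egirth)
    (hG : G.Connected) (hmin : ∀ v : V, 2 ≤ G.degree v) {v : V} (hv : 3 ≤ G.degree v) :
    CircularlyPartite G t := by
  classical
  have : NeZero t := ⟨by omega⟩
  have : Nonempty V := ⟨v⟩
  obtain ⟨F, heven, hF⟩ := hκ.exists_profile hgirth hG hmin hv
  have hFs := surjective_of_profile hmin hsurj hF
  have htwo : (2 : ZMod t) ≠ 0 := by
    intro h
    have := (ZMod.natCast_eq_zero_iff 2 t).1 (by exact_mod_cast h)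
    exact absurd (Nat.le_of_dvd (by norm_num) this) (by omega)
  have huniq : ∀ i j, F i = F j → F (i + 1) = F (j + 1) → i = j := by
    intro i j h0 h1
    rcases eq_or_eq_neg_of_even heven hFs h0 with h | h
    · exact h
    rcases eq_or_eq_neg_of_even heven hFs h1 with h' | h'
    · exact add_right_cancel h'
    · exact absurd (by linear_combination h' - h) htwo
  have hex : ∀ u w, ∃ i, G.Adj u w → κ u = F i ∧ κ w = F (i + 1) := by
    intro u w
    by_cases huw : G.Adj u w
    · obtain ⟨z, hz, hne⟩ := exists_adj_ne hmin u w
      obtain ⟨d, h0, h1, -⟩ := hF u w z huw hz hne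
      exact ⟨d - 1, fun _ => ⟨h0, by simpa using h1⟩⟩
    · exact ⟨0, fun h => absurd h huw⟩
  choose c hc using hex
  have hstep : ∀ u w z, G.Adj u w → G.Adj w z → z ≠ u → c w z = c u w + 1 := by
    intro u w z huw hwz hne
    obtain ⟨d, h0, h1, h2⟩ := hF u w z huw hwz hne
    have e1 : c u w = d - 1 := huniq _ _ ((hc u w huw).1.symm.trans h0)
      (by rw [← (hc u w huw).2, h1]; simp)
    have e2 : c w z = d := huniq _ _ ((hc w z hwz).1.symm.trans h1)
      ((hc w z hwz).2.symm.trans h2)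
    rw [e1, e2]; ring
  exact ⟨by omega, c, exists_circular_class hmin hstep, hstep⟩

theorem IsCircularColoring.exists_add_swap {t : ℕ} {c : V → V → ZMod t}
    (hc : IsCircularColoring G t c) (hG : G.Connected) {v : V} (hv : 3 ≤ G.degree v) :
    ∃ s, ∀ w z, G.Adj w z → c w z + c z w = 2 * s - 1 := by
  have hstep := hc.2
  obtain ⟨a, ha, -, -⟩ := exists_adj_ne_ne hv v v
  refine ⟨c v a, fun w => ?_⟩
  obtain ⟨p⟩ := hG.preconnected w v
  induction p with
  | @nil v =>
    intro z hz
    have hz1 : c v z = c v a := by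
      obtain ⟨y, hy, hya, hyz⟩ := exists_adj_ne_ne hv a z
      rw [hstep y v z hy.symm hz hyz.symm, hstep y v a hy.symm ha hya.symm]
    obtain ⟨y, hy, hyz, -⟩ := exists_adj_ne_ne hv z a
    obtain ⟨x, hx, hxy, hxa⟩ := exists_adj_ne_ne hv y a
    have hy1 : c v y = c v a := by
      rw [hstep x v y hx.symm hy hxy.symm, hstep x v a hx.symm ha hxa.symm]
    have := hstep z v y hz.symm hy hyz
    linear_combination hz1 + hy1 - this
  | @cons w w' v h p ih =>
    have ih := ih hv ha
    intro z hz
    by_cases hzw : z = w'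
    · subst hzw
      rw [add_comm]; exact ih _ h.symm
    · have h1 := hstep w' w z h.symm hz hzw
      have h2 := hstep z w w' hz.symm h (Ne.symm hzw)
      linear_combination h1 - h2 + ih _ h.symm

theorem CircularlyPartite.exists_isPeriodicColoring {t : ℕ} (h : CircularlyPartite G t)
    (hG : G.Connected) (hmin : ∀ v : V, 2 ≤ G.degree v) {v : V} (hv : 3 ≤ G.degree v) :
    ∃ κ : V → Fin (t / 2 + 1), Surjective κ ∧ IsPeriodicColoring G t κ := by
  obtain ⟨ht, c, hc⟩ := h
  have : NeZero t := ⟨by omega⟩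
  obtain ⟨s, hs⟩ := hc.exists_add_swap hG hv
  choose nb hnb _ using fun w => exists_adj_ne hmin w w
  let κ : V → Fin (t / 2 + 1) := fun w =>
    ⟨(c w (nb w) - s).valMinAbs.natAbs, Nat.lt_succ_of_le (ZMod.natAbs_valMinAbs_le _)⟩
  have hκ : ∀ w z, G.Adj w z → (κ w : ℕ) = (c w z - s).valMinAbs.natAbs := by
    intro w z hz
    refine ZMod.natAbs_valMinAbs_eq_natAbs_valMinAbs.2 ?_
    by_cases hne : z = nb w
    · subst hne; exact .inl rfl
    · right
      have h1 := hs w z hz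
      have h2 := hc.2 z w (nb w) hz.symm (hnb w) (Ne.symm hne)
      linear_combination h2 + h1
  refine ⟨κ, fun k => ?_, fun u v p hp hlen => ?_⟩
  · obtain ⟨w, z, hwz, h⟩ := hc.1 (s + (k : ℕ))
    refine ⟨w, Fin.ext ?_⟩
    rw [hκ w z hwz, h, add_sub_cancel_left,
      ZMod.valMinAbs_natCast_of_le_half (Nat.le_of_lt_succ k.2), Int.natAbs_natCast]
  · obtain ⟨m, rfl⟩ : ∃ m, t = m + 1 := ⟨t - 1, by omega⟩
    have h0 := p.adj_getVert_succ (i := 0) (by omega)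
    have h1 := p.adj_getVert_succ (i := m) (by omega)
    have hcm := hc.apply_getVert hp m (by omega)
    have hv : p.getVert (m + 1) = v := by rw [← hlen]; exact p.getVert_length
    rw [hv] at h1 hcm
    rw [p.getVert_zero] at h0 hcm
    refine Fin.ext ?_
    rw [hκ _ _ h0, hκ _ _ h1.symm]
    refine ZMod.natAbs_valMinAbs_eq_natAbs_valMinAbs.2 (.inr ?_)
    have hm : (m : ZMod (m + 1)) + 1 = 0 := by exact_mod_cast ZMod.natCast_self (m + 1)
    linear_combination hs _ _ h1 - hcm - hm

end Colorings

/-- for a connected graph with minimum degree `≥ 2` which is not a cycle,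
and `3 ≤ t` at most the shortest cycle length, `χ_t(G) = ⌊t/2⌋ + 1` iff `G` is
circularly `t`-partite. -/
theorem stmt_18 {V : Type*} [Fintype V] (G : SimpleGraph V) [DecidableRel G.Adj]
    (hG : G.Connected) (hmin : ∀ v : V, 2 ≤ G.degree v)
    (hnotcyc : ¬ ∃ n, Nonempty (G ≃g cycleGraph n))
    (t : ℕ) (ht : 3 ≤ t) (hgirth : (t : ℕ∞) ≤ G.egirth) :
    chiT G t = t / 2 + 1 ↔ CircularlyPartite G t := by
  have : NeZero t := ⟨by omega⟩
  obtain ⟨v, hv⟩ := exists_three_le_degree hG hmin hnotcyc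
  set S := {k | ∃ c : V → Fin k, Surjective c ∧ IsPeriodicColoring G t c}
  have hle : ∀ k ∈ S, k ≤ t / 2 + 1 := fun k ⟨_, hsurj, hc⟩ =>
    hc.card_le hsurj hgirth hG hmin hv
  have hbdd : BddAbove S := ⟨_, hle⟩
  constructor
  · intro h
    have hne : S.Nonempty := by
      by_contra hne
      rw [chiT, show {k | ∃ c : V → Fin k, Surjective c ∧ IsPeriodicColoring G t c} = ∅ from
        Set.not_nonempty_iff_eq_empty.1 hne] at h
      simp at h
    have hmem : chiT G t ∈ S := Nat.sSup_mem hne hbdd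
    rw [h] at hmem
    obtain ⟨κ, hsurj, hκ⟩ := hmem
    exact hκ.circularlyPartite ht hsurj hgirth hG hmin hv
  · intro h
    have hmem : t / 2 + 1 ∈ S := h.exists_isPeriodicColoring hG hmin hv
    exact le_antisymm (csSup_le ⟨_, hmem⟩ hle) (le_csSup hbdd hmem)
end
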